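/- arXiv:2212.02243 — 3 statements merged into one kernel-verified Lean document; each statement's English description precedes it below -/
import Mathlib

section
/- With the conventions below, for all X, Y ∈ 𝔤 the Nijenhuis torsion of φ satisfies: N_φ(φX,φY) = -N_φ(X,Y) - 2 dη(X,Y) ξ - 2 dη(φX,φY) ξ + (η(X)(L_ξη)(Y) - η(Y)(L_ξη)(X)) ξ - η(X) φ((L_ξφ)(Y)) + η(Y) φ((L_ξφ)(X)). -/
/-- The algebraic Nijenhuis torsion of a linear endomorphism `φ` of a Lie algebra:
`N_φ(X,Y) = φ(φ[X,Y]) + [φX,φY] - φ[φX,Y] - φ[X,φY]`. -/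
def nijenhuisTorsion {𝔤 : Type*} [LieRing 𝔤] [LieAlgebra ℝ 𝔤]
    (φ : 𝔤 →ₗ[ℝ] 𝔤) (X Y : 𝔤) : 𝔤 :=
  φ (φ ⁅X, Y⁆) + ⁅φ X, φ Y⁆ - φ ⁅φ X, Y⁆ - φ ⁅X, φ Y⁆

/-- The (left-invariant) exterior derivative of the 1-form `η`:
`dη(X,Y) = -(1/2) η([X,Y])`. -/
noncomputable def dEta {𝔤 : Type*} [LieRing 𝔤] [LieAlgebra ℝ 𝔤]
    (η : 𝔤 →ₗ[ℝ] ℝ) (X Y : 𝔤) : ℝ :=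
  -(1 / 2 : ℝ) * η ⁅X, Y⁆

/-- The (left-invariant) Lie derivative of `η` along `ξ`: `(L_ξη)(X) = -η([ξ,X])`. -/
noncomputable def lieDerEta {𝔤 : Type*} [LieRing 𝔤] [LieAlgebra ℝ 𝔤]
    (ξ : 𝔤) (η : 𝔤 →ₗ[ℝ] ℝ) (X : 𝔤) : ℝ :=
  -η ⁅ξ, X⁆

/-- The (left-invariant) Lie derivative of `φ` along `ξ`: `(L_ξφ)(X) = [ξ,φX] - φ[ξ,X]`. -/
def lieDerPhi {𝔤 : Type*} [LieRing 𝔤] [LieAlgebra ℝ 𝔤]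
    (ξ : 𝔤) (φ : 𝔤 →ₗ[ℝ] 𝔤) (X : 𝔤) : 𝔤 :=
  ⁅ξ, φ X⁆ - φ ⁅ξ, X⁆

/-- For an (algebraic) almost contact structure `(φ, ξ, η)` on a real Lie algebra, the
Nijenhuis torsion of `φ` satisfies
`N_φ(φX,φY) = -N_φ(X,Y) - 2dη(X,Y)ξ - 2dη(φX,φY)ξ + (η(X)(L_ξη)(Y) - η(Y)(L_ξη)(X))ξ
  - η(X) φ((L_ξφ)Y) + η(Y) φ((L_ξφ)X)`. -/
theorem nijenhuis_phi_phi {𝔤 : Type*} [LieRing 𝔤] [LieAlgebra ℝ 𝔤]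
    (φ : 𝔤 →ₗ[ℝ] 𝔤) (ξ : 𝔤) (η : 𝔤 →ₗ[ℝ] ℝ)
    (hφφ : ∀ X : 𝔤, φ (φ X) = -X + η X • ξ)
    (hηξ : η ξ = 1) (hφξ : φ ξ = 0) (hηφ : ∀ X : 𝔤, η (φ X) = 0)
    (X Y : 𝔤) :
    nijenhuisTorsion φ (φ X) (φ Y) =
      -nijenhuisTorsion φ X Y - (2 * dEta η X Y) • ξ - (2 * dEta η (φ X) (φ Y)) • ξ
        + (η X * lieDerEta ξ η Y - η Y * lieDerEta ξ η X) • ξ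
        - η X • φ (lieDerPhi ξ φ Y) + η Y • φ (lieDerPhi ξ φ X) := by
  have hX : ⁅X, ξ⁆ = -⁅ξ, X⁆ := (lie_skew X ξ).symm
  have hφX : ⁅φ X, ξ⁆ = -⁅ξ, φ X⁆ := (lie_skew (φ X) ξ).symm
  simp only [nijenhuisTorsion, dEta, lieDerEta, lieDerPhi, hφφ, map_add, map_sub, map_neg,
    map_smul, lie_add, add_lie, lie_neg, neg_lie, lie_smul, smul_lie, lie_self, hX, hφX]
  module
end

section
/- Let E be a finite-dimensional real inner product space with dim E ≥ 2, ξ ∈ E a unit vector, S : E → E a skew-symmetric linear map with Sξ = 0, and c ∈ ℝ such that ‖SX‖² = c for every unit vector X orthogonal to ξ (constant ξ-sectional curvature condition). Then S²X = -c(X - ⟨X,ξ⟩ξ) for all X ∈ E, and if S ≠ 0 then c > 0. -/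
open RealInnerProductSpace

/-- A linear map with constant value `c` of `‖S X‖ ^ 2` on unit vectors orthogonal to `ξ`
satisfies `‖S X‖ ^ 2 = c * ‖X‖ ^ 2` on all vectors orthogonal to `ξ`. -/
theorem norm_map_sq_of_orthogonal {E F : Type*} [NormedAddCommGroup E] [InnerProductSpace ℝ E]
    [NormedAddCommGroup F] [NormedSpace ℝ F] {ξ : E} {S : E →ₗ[ℝ] F} {c : ℝ}
    (hc : ∀ X : E, ‖X‖ = 1 → ⟪X, ξ⟫ = 0 → ‖S X‖ ^ 2 = c) {X : E} (hX : ⟪X, ξ⟫ = 0) :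
    ‖S X‖ ^ 2 = c * ‖X‖ ^ 2 := by
  rcases eq_or_ne X 0 with rfl | h0
  · simp
  have hn : ‖X‖ ≠ 0 := norm_ne_zero_iff.mpr h0
  have h := hc (‖X‖⁻¹ • X) (norm_smul_inv_norm (𝕜 := ℝ) h0) (by simp [inner_smul_left, hX])
  rw [map_smul, norm_smul, norm_inv, norm_norm] at h
  rw [← h]
  field_simp

/-- If moreover `S ξ = 0` with `ξ` a unit vector, then `‖S X‖ ^ 2` is `c` times the squared norm of
the component of `X` orthogonal to `ξ`. -/
theorem norm_map_sq_eq {E F : Type*} [NormedAddCommGroup E] [InnerProductSpace ℝ E]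
    [NormedAddCommGroup F] [NormedSpace ℝ F] {ξ : E} (hξ : ‖ξ‖ = 1) {S : E →ₗ[ℝ] F}
    (hSξ : S ξ = 0) {c : ℝ} (hc : ∀ X : E, ‖X‖ = 1 → ⟪X, ξ⟫ = 0 → ‖S X‖ ^ 2 = c) (X : E) :
    ‖S X‖ ^ 2 = c * ‖X - ⟪X, ξ⟫ • ξ‖ ^ 2 := by
  have h : ⟪X - ⟪X, ξ⟫ • ξ, ξ⟫ = 0 := by
    simp [inner_sub_left, inner_smul_left, hξ]
  simpa [hSξ] using norm_map_sq_of_orthogonal hc h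

/-- Let `E` be a finite-dimensional real inner product space with `dim E ≥ 2`, `ξ` a unit
vector, `S` a skew-symmetric linear map with `Sξ = 0`, and `c ∈ ℝ` such that
`‖SX‖² = c` for every unit vector `X` orthogonal to `ξ` (constant ξ-sectional curvature).
Then `S²X = -c(X - ⟨X,ξ⟩ξ)` for all `X`, and if `S ≠ 0` then `c > 0`. -/
theorem constant_xi_sectional_curvature {E : Type*} [NormedAddCommGroup E]
    [InnerProductSpace ℝ E] [FiniteDimensional ℝ E]
    (hdim : 2 ≤ Module.finrank ℝ E)
    (ξ : E) (hξ : ‖ξ‖ = 1)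
    (S : E →ₗ[ℝ] E) (hskew : ∀ X Y : E, ⟪S X, Y⟫ = -⟪X, S Y⟫) (hSξ : S ξ = 0)
    (c : ℝ) (hc : ∀ X : E, ‖X‖ = 1 → ⟪X, ξ⟫ = 0 → ‖S X‖ ^ 2 = c) :
    (∀ X : E, S (S X) = -c • (X - ⟪X, ξ⟫ • ξ)) ∧ (S ≠ 0 → 0 < c) := by
  have hnorm := norm_map_sq_eq hξ hSξ hc
  refine ⟨fun X => ext_inner_right ℝ fun Y => ?_, fun hS => ?_⟩
  · have hquad (Z : E) : ⟪S Z, S Z⟫ = c * (⟪Z, Z⟫ - ⟪Z, ξ⟫ ^ 2) := by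
      rw [real_inner_self_eq_norm_sq, hnorm, ← real_inner_self_eq_norm_sq]
      simp only [inner_sub_left, inner_sub_right, inner_smul_left, inner_smul_right,
        real_inner_self_eq_norm_sq ξ, hξ, real_inner_comm Z ξ, conj_trivial]
      ring
    have hadd := hquad (X + Y)
    simp only [map_add, inner_add_left, inner_add_right, real_inner_comm X Y,
      real_inner_comm (S X) (S Y)] at hadd
    rw [hskew, inner_smul_left, inner_sub_left, inner_smul_left, real_inner_comm Y ξ]
    simp only [conj_trivial]
    linarith [hquad X, hquad Y]
  · obtain ⟨X, hX⟩ : ∃ X, S X ≠ 0 := by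
      simpa [LinearMap.ext_iff] using hS
    have hpos : 0 < c * ‖X - ⟪X, ξ⟫ • ξ‖ ^ 2 := by
      rw [← hnorm]
      positivity
    exact pos_of_mul_pos_left hpos (sq_nonneg _)
end

section
/- On 𝔥, the Nijenhuis torsion N_φ(Z,W) = φ(φ([Z,W])) + [φZ,φW] - φ[φZ,W] - φ[Z,φW] satisfies N_φ(Z,W) = -η([Z,W])ξ for all Z, W ∈ 𝔥 (the anti-quasi-Sasakian condition N_φ = 2dη ⊗ ξ for this left-invariant model, where dη(Z,W) = -(1/2)η([Z,W])). -/
/-- The bracket `[(s,u,v),(s',u',v')] = (2a(u,v') - 2a(u',v), 0, 0)` on `𝔥 = ℝ × V × V`. -/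
noncomputable def heisBracket {V : Type*} [NormedAddCommGroup V] [InnerProductSpace ℝ V]
    (a : V →ₗ[ℝ] V →ₗ[ℝ] ℝ) (Z W : ℝ × V × V) : ℝ × V × V :=
  (2 * a Z.2.1 W.2.2 - 2 * a W.2.1 Z.2.2, 0, 0)

/-- The element `ξ = (1,0,0)` of `𝔥 = ℝ × V × V`. -/
def heisXi (V : Type*) [NormedAddCommGroup V] [InnerProductSpace ℝ V] : ℝ × V × V :=
  (1, 0, 0)

/-- The linear functional `η(s,u,v) = s` on `𝔥 = ℝ × V × V`. -/
def heisEta {V : Type*} [NormedAddCommGroup V] [InnerProductSpace ℝ V]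
    (Z : ℝ × V × V) : ℝ :=
  Z.1

/-- The linear map `φ(s,u,v) = (0,-v,u)` on `𝔥 = ℝ × V × V`. -/
def heisPhi {V : Type*} [NormedAddCommGroup V] [InnerProductSpace ℝ V]
    (Z : ℝ × V × V) : ℝ × V × V :=
  (0, -Z.2.2, Z.2.1)

/-- The Nijenhuis torsion `N_φ(Z,W) = φ(φ[Z,W]) + [φZ,φW] - φ[φZ,W] - φ[Z,φW]`
for the bracket `heisBracket a` on `𝔥 = ℝ × V × V`. -/
noncomputable def heisNijenhuis {V : Type*} [NormedAddCommGroup V] [InnerProductSpace ℝ V]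
    (a : V →ₗ[ℝ] V →ₗ[ℝ] ℝ) (Z W : ℝ × V × V) : ℝ × V × V :=
  heisPhi (heisPhi (heisBracket a Z W)) + heisBracket a (heisPhi Z) (heisPhi W)
    - heisPhi (heisBracket a (heisPhi Z) W) - heisPhi (heisBracket a Z (heisPhi W))

/-- On `𝔥 = ℝ × V × V` the Nijenhuis torsion of `φ` satisfies
`N_φ(Z,W) = -η([Z,W])ξ`, i.e. the anti-quasi-Sasakian condition `N_φ = 2dη ⊗ ξ`
(with `dη(Z,W) = -(1/2)η([Z,W])`). -/
theorem heis_aqs_condition {V : Type*} [NormedAddCommGroup V] [InnerProductSpace ℝ V]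
    [FiniteDimensional ℝ V]
    (a : V →ₗ[ℝ] V →ₗ[ℝ] ℝ) (ha : ∀ u v : V, a u v = -a v u)
    (Z W : ℝ × V × V) :
    heisNijenhuis a Z W = -heisEta (heisBracket a Z W) • heisXi V := by
  have h₁ := ha W.2.1 Z.2.2
  have h₂ := ha Z.2.1 W.2.2
  ext <;> simp [heisNijenhuis, heisPhi, heisBracket, heisEta, heisXi]
  linarith
end
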